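/- Let O ⊆ ℝ² be a compact nonempty set with nonempty complement, D(x) = infDist(x, frontier O), and let Σ = { x ∈ O | for all y ∈ O, closedBall(x, D(x)) is not a proper subset of closedBall(y, D(y)) } be the medial axis of O. Then the skeleton is an equivalent shape descriptor: ⋃_{x ∈ Σ} closedBall(x, D(x)) = O. -/

import Mathlib

open Metric

/-- A preconnected set that meets both a closed set and its complement meets the frontier of that
closed set. -/
theorem IsPreconnected.inter_frontier_nonempty_of_isClosed {X : Type*} [TopologicalSpace X]
    {s t : Set X} (ht : IsPreconnected t) (hs : IsClosed s) (hts : (t ∩ s).Nonempty)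
    (htsc : (t ∩ sᶜ).Nonempty) : (t ∩ frontier s).Nonempty := by
  by_contra hempty
  have hint : ∀ x ∈ t, x ∈ s → x ∈ interior s := fun x hxt hxs => by
    by_contra hxi
    exact hempty ⟨x, hxt, hs.frontier_eq ▸ ⟨hxs, hxi⟩⟩
  obtain ⟨x, hxt, hxs⟩ := hts
  obtain ⟨y, -, hyi, hyc⟩ := ht (interior s) sᶜ isOpen_interior hs.isOpen_compl
    (fun w hw => (em (w ∈ s)).imp_left (hint w hw)) ⟨x, hxt, hint x hxt hxs⟩ htsc
  exact hyc (interior_subset hyi)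

/-- In a real normed space, the distance from a point of a closed set to the frontier of that set
is a radius of a closed ball inscribed in the set. -/
theorem closedBall_infDist_frontier_subset {E : Type*} [NormedAddCommGroup E] [NormedSpace ℝ E]
    {s : Set E} (hs : IsClosed s) {x : E} (hx : x ∈ s) :
    closedBall x (infDist x (frontier s)) ⊆ s := by
  intro z hz
  by_contra hzs
  obtain ⟨w, hw, hws⟩ : (segment ℝ x z ∩ frontier s).Nonempty :=
    (convex_segment x z).isPreconnected.inter_frontier_nonempty_of_isClosed hs
      ⟨x, left_mem_segment ℝ x z, hx⟩ ⟨z, right_mem_segment ℝ x z, hzs⟩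
  have hxw : infDist x (frontier s) ≤ dist x w := infDist_le_dist_of_mem hws
  have hadd := dist_add_dist_of_mem_segment hw
  rw [mem_closedBall, dist_comm] at hz
  have hwz : w = z := dist_le_zero.1 (by linarith)
  exact hzs (hwz ▸ hs.frontier_subset hws)

/-- In a real normed space, if a closed ball is contained in another one with a different centre,
then the distance of the centres is at most the difference of the radii. -/
theorem dist_add_le_of_closedBall_subset_closedBall {E : Type*} [NormedAddCommGroup E]
    [NormedSpace ℝ E] {x y : E} {r R : ℝ} (hxy : x ≠ y) (hr : 0 ≤ r)
    (h : closedBall x r ⊆ closedBall y R) : dist x y + r ≤ R := by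
  have hpos : 0 < ‖x - y‖ := norm_pos_iff.2 (sub_ne_zero.2 hxy)
  have hmem : x + (r / ‖x - y‖) • (x - y) ∈ closedBall x r := by
    rw [mem_closedBall, dist_eq_norm, add_sub_cancel_left, norm_smul, Real.norm_of_nonneg
      (by positivity), div_mul_cancel₀ _ hpos.ne']
  have hR := h hmem
  have heq : x + (r / ‖x - y‖) • (x - y) - y = (1 + r / ‖x - y‖) • (x - y) := by
    rw [add_smul, one_smul]
    abel
  rw [mem_closedBall, dist_eq_norm, heq, norm_smul, Real.norm_of_nonneg (by positivity), add_mul,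
    one_mul, div_mul_cancel₀ _ hpos.ne'] at hR
  rwa [dist_eq_norm]

/-- the medial axis (skeleton), i.e. the set of centres of
inscribed disks of maximal radius, is an equivalent shape descriptor: the
union of the inscribed disks centred on the skeleton recovers the object. -/
theorem medial_axis_equivalent_shape_descriptor
    (O : Set (EuclideanSpace ℝ (Fin 2)))
    (hO : IsCompact O) (hOne : O.Nonempty) (hOc : Oᶜ.Nonempty)
    (D : EuclideanSpace ℝ (Fin 2) → ℝ)
    (hD : ∀ x, D x = Metric.infDist x (frontier O))
    (Sk : Set (EuclideanSpace ℝ (Fin 2)))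
    (hSk : Sk = {x ∈ O | ∀ y ∈ O,
      ¬ (Metric.closedBall x (D x) ⊂ Metric.closedBall y (D y))}) :
    ⋃ x ∈ Sk, Metric.closedBall x (D x) = O := by
  subst hSk
  obtain rfl : D = fun x => infDist x (frontier O) := funext hD
  refine Set.Subset.antisymm
    (Set.iUnion₂_subset fun x hx => closedBall_infDist_frontier_subset hO.isClosed hx.1)
    fun p hp => ?_
  have hcont : Continuous fun x => infDist x (frontier O) := continuous_infDist_pt _
  have hcomp : IsCompact
      (O ∩ {y | dist y p + infDist p (frontier O) ≤ infDist y (frontier O)}) :=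
    hO.inter_right (isClosed_le (by fun_prop) hcont)
  obtain ⟨y, ⟨hyO, hy⟩, hmax⟩ := hcomp.exists_isMaxOn ⟨p, hp, by simp⟩ hcont.continuousOn
  rw [Set.mem_ofPred_eq] at hy
  refine Set.mem_iUnion₂.2 ⟨y, ⟨hyO, fun z hzO hyz => ?_⟩, ?_⟩
  · have hne : y ≠ z := by
      rintro rfl
      exact hyz.ne rfl
    have hle := dist_add_le_of_closedBall_subset_closedBall hne infDist_nonneg hyz.subset
    have htri := dist_triangle_left z p y
    have hzy : infDist z (frontier O) ≤ infDist y (frontier O) :=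
      hmax ⟨hzO, by rw [Set.mem_ofPred_eq]; linarith⟩
    linarith [dist_pos.2 hne]
  · rw [mem_closedBall, dist_comm]
    linarith [infDist_nonneg (x := p) (s := frontier O)]
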